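/- Let X be a topological space and A a subset of X. Then A is a-locally closed if and only if A ⊆ a-int(A ∪ (X \ a-cl(A))). -/

import Mathlib

open Set Topology

/-- A set is regular open if it equals the interior of its closure. -/
def RegOpen {X : Type*} [TopologicalSpace X] (U : Set X) : Prop :=
  U = interior (closure U)

/-- The δ-interior of `A`: the union of all regular open sets contained in `A`. -/
def deltaInt {X : Type*} [TopologicalSpace X] (A : Set X) : Set X :=
  ⋃₀ {U : Set X | RegOpen U ∧ U ⊆ A}

/-- The δ-closure of `A`: the complement of the δ-interior of the complement. -/
def deltaCl {X : Type*} [TopologicalSpace X] (A : Set X) : Set X :=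
  (deltaInt Aᶜ)ᶜ

/-- `A` is a-open if `A ⊆ int(cl(δ-int A))`. -/
def AOpen {X : Type*} [TopologicalSpace X] (A : Set X) : Prop :=
  A ⊆ interior (closure (deltaInt A))

/-- `A` is a-closed if its complement is a-open. -/
def AClosed {X : Type*} [TopologicalSpace X] (A : Set X) : Prop :=
  AOpen Aᶜ

/-- `A` is a-locally closed if it is the intersection of an a-open and an a-closed set. -/
def ALocallyClosed {X : Type*} [TopologicalSpace X] (A : Set X) : Prop :=
  ∃ U V : Set X, AOpen U ∧ AClosed V ∧ A = U ∩ V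

/-- `A` is e-open if `A ⊆ cl(δ-int A) ∪ int(δ-cl A)`. -/
def EOpen {X : Type*} [TopologicalSpace X] (A : Set X) : Prop :=
  A ⊆ closure (deltaInt A) ∪ interior (deltaCl A)

/-- `A` is e-closed if its complement is e-open. -/
def EClosed {X : Type*} [TopologicalSpace X] (A : Set X) : Prop :=
  EOpen Aᶜ

/-- `A` is e-locally closed if it is the intersection of an e-open and an e-closed set. -/
def ELocallyClosed {X : Type*} [TopologicalSpace X] (A : Set X) : Prop :=
  ∃ U V : Set X, EOpen U ∧ EClosed V ∧ A = U ∩ V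

/-- The a-closure of `A`: the intersection of all a-closed supersets of `A`. -/
def aCl {X : Type*} [TopologicalSpace X] (A : Set X) : Set X :=
  ⋂₀ {F : Set X | AClosed F ∧ A ⊆ F}

/-- The a-interior of `A`: the union of all a-open subsets of `A`. -/
def aInt {X : Type*} [TopologicalSpace X] (A : Set X) : Set X :=
  ⋃₀ {U : Set X | AOpen U ∧ U ⊆ A}

/-- The e-closure of `A`: the intersection of all e-closed supersets of `A`. -/
def eCl {X : Type*} [TopologicalSpace X] (A : Set X) : Set X :=
  ⋂₀ {F : Set X | EClosed F ∧ A ⊆ F}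

/-- `S` is semi-open if `S ⊆ cl(int S)`. -/
def SemiOpen {X : Type*} [TopologicalSpace X] (S : Set X) : Prop :=
  S ⊆ closure (interior S)

/-- `S` is semi-closed if its complement is semi-open. -/
def SemiClosed {X : Type*} [TopologicalSpace X] (S : Set X) : Prop :=
  SemiOpen Sᶜ

/-- The semi-closure of `U`: the intersection of all semi-closed supersets of `U`. -/
def sCl {X : Type*} [TopologicalSpace X] (U : Set X) : Set X :=
  ⋂₀ {F : Set X | SemiClosed F ∧ U ⊆ F}

/-- `A` is feebly open if there is an open `U` with `U ⊆ A ⊆ scl(U)`. -/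
def FeeblyOpen {X : Type*} [TopologicalSpace X] (A : Set X) : Prop :=
  ∃ U : Set X, IsOpen U ∧ U ⊆ A ∧ A ⊆ sCl U

/-- `A` is feebly closed if its complement is feebly open. -/
def FeeblyClosed {X : Type*} [TopologicalSpace X] (A : Set X) : Prop :=
  FeeblyOpen Aᶜ

/-- `A` is feebly locally closed if it is the intersection of a feebly open and a
feebly closed set. -/
def FeeblyLocallyClosed {X : Type*} [TopologicalSpace X] (A : Set X) : Prop :=
  ∃ U V : Set X, FeeblyOpen U ∧ FeeblyClosed V ∧ A = U ∩ V

/-- `A` is α-open if `A ⊆ int(cl(int A))`. -/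
def AlphaOpen {X : Type*} [TopologicalSpace X] (A : Set X) : Prop :=
  A ⊆ interior (closure (interior A))

/-- `A` is α-closed if its complement is α-open. -/
def AlphaClosed {X : Type*} [TopologicalSpace X] (A : Set X) : Prop :=
  AlphaOpen Aᶜ

/-- `A` is α-locally closed if it is the intersection of an α-open and an α-closed set. -/
def AlphaLocallyClosed {X : Type*} [TopologicalSpace X] (A : Set X) : Prop :=
  ∃ U V : Set X, AlphaOpen U ∧ AlphaClosed V ∧ A = U ∩ V

/-- `X` is submaximal if every dense subset of `X` is open. -/
def Submaximal (X : Type*) [TopologicalSpace X] : Prop :=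
  ∀ A : Set X, closure A = univ → IsOpen A

/-- `X` is a-submaximal if every a-dense subset of `X` is a-open. -/
def ASubmaximal (X : Type*) [TopologicalSpace X] : Prop :=
  ∀ A : Set X, aCl A = univ → AOpen A

/-- `X` is e-submaximal if every e-dense subset of `X` is e-open. -/
def ESubmaximal (X : Type*) [TopologicalSpace X] : Prop :=
  ∀ A : Set X, eCl A = univ → EOpen A

/-- `X` is an e-space if a subset is open precisely when it is e-open. -/
def IsESpace (X : Type*) [TopologicalSpace X] : Prop :=
  ∀ A : Set X, IsOpen A ↔ EOpen A

theorem deltaInt_mono_aux {X : Type*} [TopologicalSpace X] {A B : Set X} (h : A ⊆ B) :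
    deltaInt A ⊆ deltaInt B :=
  sUnion_subset_sUnion fun _ hU => ⟨hU.1, hU.2.trans h⟩

theorem AOpen_sUnion_aux {X : Type*} [TopologicalSpace X] {S : Set (Set X)}
    (h : ∀ U ∈ S, AOpen U) : AOpen (⋃₀ S) :=
  sUnion_subset fun U hU => (h U hU).trans
    (interior_mono (closure_mono (deltaInt_mono_aux (subset_sUnion_of_mem hU))))

theorem AClosed_aCl_aux {X : Type*} [TopologicalSpace X] (A : Set X) : AClosed (aCl A) := by
  unfold AClosed aCl
  rw [compl_sInter]
  apply AOpen_sUnion_aux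
  rintro _ ⟨F, hF, rfl⟩
  exact hF.1

theorem aLocallyClosed_iff_subset_aInt {X : Type*} [TopologicalSpace X] (A : Set X) :
    ALocallyClosed A ↔ A ⊆ aInt (A ∪ (aCl A)ᶜ) := by
  constructor
  · rintro ⟨U, V, hU, hV, hA⟩ x hx
    have hcl : aCl A ⊆ V := sInter_subset_of_mem ⟨hV, hA ▸ inter_subset_right⟩
    refine ⟨U, ⟨hU, fun y hy => ?_⟩, (hA ▸ hx : x ∈ U ∩ V).1⟩
    by_cases hyc : y ∈ aCl A
    · left
      rw [hA]
      exact ⟨hy, hcl hyc⟩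
    · exact Or.inr hyc
  · intro h
    refine ⟨aInt (A ∪ (aCl A)ᶜ), aCl A, AOpen_sUnion_aux fun U hU => hU.1,
      AClosed_aCl_aux A, ?_⟩
    apply Subset.antisymm
    · exact fun x hx => ⟨h hx, fun F hF => hF.2 hx⟩
    · rintro x ⟨⟨U, hU, hxU⟩, hxc⟩
      exact (hU.2 hxU).resolve_right fun hn => hn hxc
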